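/- arXiv:2407.18301 — 3 statements merged into one kernel-verified Lean document; each statement's English description precedes it below -/
import Mathlib

section
/- Explicit minimum-gap bound for the ground level: take the edge-case vector with dominant index i = 0. Then for every ε > 0 with (N−1)ε² < 1/2 and every μ > 0, the lowest eigenvalue of H(μ) satisfies d_1 − s_0(μ) > ε² (d_1 − d_0)/2; combined with s_1(μ) ≥ d_1 this yields s_1(μ) − s_0(μ) > ε² (d_1 − d_0)/2. -/
open Matrix BigOperators

/-- Inner product on `ι → ℂ`, conjugate-linear in the first argument. -/
noncomputable def dotc {ι : Type*} [Fintype ι] (x y : ι → ℂ) : ℂ :=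
  ∑ i, (starRingEnd ℂ) (x i) * y i

/-- Euclidean norm on `ι → ℂ`. -/
noncomputable def cnorm {ι : Type*} [Fintype ι] (x : ι → ℂ) : ℝ :=
  Real.sqrt (∑ i, Complex.normSq (x i))

/-- The rank-one perturbed Hamiltonian `H(μ) = D + μ v v†`. -/
noncomputable def Hmu {N : ℕ} (D : Matrix (Fin N) (Fin N) ℂ) (v : Fin N → ℂ) (μ : ℝ) :
    Matrix (Fin N) (Fin N) ℂ :=
  D + (μ : ℂ) • Matrix.vecMulVec v (star v)

/-- The edge-case vector `v(ε)`: component `1 − (N−1)ε²` along `e i`, and `ε` along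
every other eigenvector of `D`. -/
noncomputable def edgeVec {N : ℕ} (e : Fin N → (Fin N → ℂ)) (i : Fin N) (ε : ℝ) :
    Fin N → ℂ :=
  fun x => ∑ j, (if j = i then (((1 : ℝ) - ((N : ℝ) - 1) * ε ^ 2 : ℝ) : ℂ) else (ε : ℂ)) * e j x

section Orthonormal

variable {ι : Type*} [Fintype ι]

lemma dotc_eq_dotProduct (x y : ι → ℂ) : dotc x y = star x ⬝ᵥ y := rfl

/-- A Hermitian matrix is symmetric for `dotc`. -/
lemma dotc_mulVec_of_isHermitian {M : Matrix ι ι ℂ} (hM : M.IsHermitian) (x y : ι → ℂ) :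
    dotc x (M *ᵥ y) = dotc (M *ᵥ x) y := by
  rw [dotc_eq_dotProduct, dotc_eq_dotProduct, star_mulVec, hM.eq, dotProduct_mulVec]

lemma dotc_smul_left (a : ℝ) (x y : ι → ℂ) : dotc ((a : ℂ) • x) y = a * dotc x y := by
  simp [dotc_eq_dotProduct]

variable [DecidableEq ι] {e : ι → ι → ℂ}

/-- Parseval's identity for an orthonormal basis. -/
lemma dotc_eq_sum_of_orthonormal (he : ∀ k l, dotc (e k) (e l) = if k = l then 1 else 0)
    (x y : ι → ℂ) :
    dotc x y = ∑ k, (starRingEnd ℂ) (dotc (e k) x) * dotc (e k) y := by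
  let A : Matrix ι ι ℂ := Matrix.of fun k i => (starRingEnd ℂ) (e k i)
  have hA : A * Aᴴ = 1 := by
    ext k l
    simpa [Matrix.mul_apply, A, dotc, Matrix.one_apply] using he k l
  have hA' : Aᴴ * A = 1 := mul_eq_one_comm.mp hA
  have hx : ∀ z k, dotc (e k) z = (A *ᵥ z) k := fun _ _ => rfl
  calc dotc x y = star x ⬝ᵥ ((Aᴴ * A) *ᵥ y) := by rw [hA', one_mulVec, dotc_eq_dotProduct]
    _ = star (A *ᵥ x) ⬝ᵥ (A *ᵥ y) := by
      rw [star_mulVec, ← mulVec_mulVec, dotProduct_mulVec]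
    _ = _ := by simp only [hx]; rfl

/-- The squared norm in an orthonormal basis. -/
lemma dotc_self_eq_sum (he : ∀ k l, dotc (e k) (e l) = if k = l then 1 else 0) (x : ι → ℂ) :
    dotc x x = ((∑ k, Complex.normSq (dotc (e k) x) : ℝ) : ℂ) := by
  rw [dotc_eq_sum_of_orthonormal he]
  push_cast
  exact Finset.sum_congr rfl fun k _ => (Complex.normSq_eq_conj_mul_self).symm

/-- The quadratic form of a Hermitian matrix in an orthonormal eigenbasis. -/
lemma dotc_mulVec_self_eq_sum (he : ∀ k l, dotc (e k) (e l) = if k = l then 1 else 0)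
    {M : Matrix ι ι ℂ} (hM : M.IsHermitian) {d : ι → ℝ}
    (heig : ∀ k, M *ᵥ e k = (d k : ℂ) • e k) (x : ι → ℂ) :
    dotc x (M *ᵥ x) = ((∑ k, d k * Complex.normSq (dotc (e k) x) : ℝ) : ℂ) := by
  rw [dotc_eq_sum_of_orthonormal he]
  push_cast
  refine Finset.sum_congr rfl fun k _ => ?_
  rw [dotc_mulVec_of_isHermitian hM, heig, dotc_smul_left, Complex.normSq_eq_conj_mul_self]
  ring

/-- The coefficients of a linear combination of orthonormal vectors. -/
lemma dotc_linearCombination (he : ∀ k l, dotc (e k) (e l) = if k = l then 1 else 0)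
    (c : ι → ℂ) (k : ι) : dotc (e k) (fun i => ∑ j, c j * e j i) = c k := by
  have h : (fun i => ∑ j, c j * e j i) = ∑ j, c j • e j := by
    ext i
    simp
  rw [h, dotc_eq_dotProduct, dotProduct_sum]
  simp only [dotProduct_smul, ← dotc_eq_dotProduct, he]
  simp

end Orthonormal

section RankOne

variable {N : ℕ} {D : Matrix (Fin N) (Fin N) ℂ}

lemma isHermitian_Hmu (hD : D.IsHermitian) (v : Fin N → ℂ) (μ : ℝ) :
    (Hmu D v μ).IsHermitian := by
  have h : (vecMulVec v (star v)).IsHermitian := by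
    simp [Matrix.IsHermitian, conjTranspose_vecMulVec]
  refine hD.add ?_
  rw [Matrix.IsHermitian, conjTranspose_smul, h.eq]
  simp

lemma dotc_Hmu_mulVec (v x : Fin N → ℂ) (μ : ℝ) :
    dotc x (Hmu D v μ *ᵥ x) =
      dotc x (D *ᵥ x) + ((μ * Complex.normSq (dotc v x) : ℝ) : ℂ) := by
  have h : (starRingEnd ℂ) (dotc v x) = dotc x v := by
    simp [dotc, mul_comm]
  rw [Hmu, add_mulVec, smul_mulVec, vecMulVec_mulVec]
  push_cast
  rw [Complex.normSq_eq_conj_mul_self, h]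
  simp only [dotc_eq_dotProduct, dotProduct_add, dotProduct_smul]
  simp

variable {d : Fin N → ℝ} {e : Fin N → Fin N → ℂ} {v : Fin N → ℂ} {μ : ℝ} {s : Fin N → ℝ}
  {w : Fin N → Fin N → ℂ}

/-- The quadratic form of `Hmu D v μ`, in eigenbases of `Hmu D v μ` and of `D`. -/
lemma sum_eigenvalues_Hmu (hD : D.IsHermitian)
    (he : ∀ k l, dotc (e k) (e l) = if k = l then 1 else 0)
    (heig : ∀ k, D *ᵥ e k = (d k : ℂ) • e k)
    (hw : ∀ k l, dotc (w k) (w l) = if k = l then 1 else 0)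
    (hweig : ∀ k, Hmu D v μ *ᵥ w k = (s k : ℂ) • w k) (x : Fin N → ℂ) :
    ∑ k, s k * Complex.normSq (dotc (w k) x) =
      ∑ k, d k * Complex.normSq (dotc (e k) x) + μ * Complex.normSq (dotc v x) := by
  have h := dotc_Hmu_mulVec (D := D) v x μ
  rw [dotc_mulVec_self_eq_sum hw (isHermitian_Hmu hD v μ) hweig,
    dotc_mulVec_self_eq_sum he hD heig] at h
  exact_mod_cast h

lemma sum_normSq_dotc_eq (he : ∀ k l, dotc (e k) (e l) = if k = l then 1 else 0)
    (hw : ∀ k l, dotc (w k) (w l) = if k = l then 1 else 0) (x : Fin N → ℂ) :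
    ∑ k, Complex.normSq (dotc (w k) x) = ∑ k, Complex.normSq (dotc (e k) x) := by
  exact_mod_cast (dotc_self_eq_sum hw x).symm.trans (dotc_self_eq_sum he x)

/-- A Rayleigh bound for the lowest eigenvalue, from the trial vector of the plane spanned by
`e i` and `e j` that is orthogonal to `v`. -/
lemma lowest_eigenvalue_mul_le (hD : D.IsHermitian)
    (he : ∀ k l, dotc (e k) (e l) = if k = l then 1 else 0)
    (heig : ∀ k, D *ᵥ e k = (d k : ℂ) • e k)
    (hw : ∀ k l, dotc (w k) (w l) = if k = l then 1 else 0)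
    (hweig : ∀ k, Hmu D v μ *ᵥ w k = (s k : ℂ) • w k)
    {m i j : Fin N} (hm : ∀ k, s m ≤ s k) (hij : i ≠ j) {a b : ℝ}
    (ha : dotc (e i) v = a) (hb : dotc (e j) v = b) :
    s m * (b ^ 2 + a ^ 2) ≤ d i * b ^ 2 + d j * a ^ 2 := by
  let c : Fin N → ℂ := fun k => if k = i then (b : ℂ) else if k = j then (-a : ℂ) else 0
  let x : Fin N → ℂ := fun y => ∑ k, c k * e k y
  have hx : ∀ k, dotc (e k) x = c k := dotc_linearCombination he c
  have hci : c i = b := by simp [c]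
  have hcj : c j = -a := by simp [c, hij.symm]
  have hc : ∀ k, k ≠ i ∧ k ≠ j → c k = 0 := fun k hk => by simp [c, hk.1, hk.2]
  have hvx : dotc v x = 0 := by
    rw [dotc_eq_sum_of_orthonormal he, Fintype.sum_eq_add i j hij]
    · simp only [hx, ha, hb, hci, hcj, Complex.conj_ofReal]
      ring
    · intro k hk
      rw [hx, hc k hk, mul_zero]
  have hsum : ∀ f : Fin N → ℝ, ∑ k, f k * Complex.normSq (dotc (e k) x) =
      f i * b ^ 2 + f j * a ^ 2 := by
    intro f
    rw [Fintype.sum_eq_add i j hij]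
    · simp [hx, hci, hcj, Complex.normSq_ofReal, sq]
    · intro k hk
      simp [hx, hc k hk]
  have hnorm := hsum fun _ => 1
  simp only [one_mul] at hnorm
  calc s m * (b ^ 2 + a ^ 2) = ∑ k, s m * Complex.normSq (dotc (w k) x) := by
        rw [← Finset.mul_sum, sum_normSq_dotc_eq he hw, hnorm]
    _ ≤ ∑ k, s k * Complex.normSq (dotc (w k) x) :=
        Finset.sum_le_sum fun k _ => mul_le_mul_of_nonneg_right (hm k) (Complex.normSq_nonneg _)
    _ = d i * b ^ 2 + d j * a ^ 2 := by
        rw [sum_eigenvalues_Hmu hD he heig hw hweig, hvx, hsum]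
        simp

/-- A positive rank-one perturbation does not push the second eigenvalue below the second
eigenvalue of `D`. -/
lemma second_eigenvalue_le (hD : D.IsHermitian)
    (he : ∀ k l, dotc (e k) (e l) = if k = l then 1 else 0)
    (heig : ∀ k, D *ᵥ e k = (d k : ℂ) • e k)
    (hw : ∀ k l, dotc (w k) (w l) = if k = l then 1 else 0)
    (hweig : ∀ k, Hmu D v μ *ᵥ w k = (s k : ℂ) • w k) (hμ : 0 ≤ μ)
    {i j : Fin N} (hij : i ≠ j) (hd : ∀ k, k ≠ i → d j ≤ d k) (hs : s i ≤ s j) :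
    d j ≤ s j := by
  obtain ⟨α, β, hne, hαβ⟩ : ∃ α β : ℂ, (α ≠ 0 ∨ β ≠ 0) ∧
      α * dotc (e i) (w i) + β * dotc (e i) (w j) = 0 := by
    by_cases h : dotc (e i) (w i) = 0
    · exact ⟨1, 0, by simp, by simp [h]⟩
    · exact ⟨-dotc (e i) (w j), dotc (e i) (w i), Or.inr h, by ring⟩
  let c : Fin N → ℂ := fun k => if k = i then α else if k = j then β else 0
  let x : Fin N → ℂ := fun y => ∑ k, c k * w k y
  have hx : ∀ k, dotc (w k) x = c k := dotc_linearCombination hw c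
  have hci : c i = α := by simp [c]
  have hcj : c j = β := by simp [c, hij.symm]
  have hc : ∀ k, k ≠ i ∧ k ≠ j → c k = 0 := fun k hk => by simp [c, hk.1, hk.2]
  have hex : dotc (e i) x = 0 := by
    have h : (starRingEnd ℂ) (dotc (e i) x) = 0 := by
      have hconj : ∀ y z : Fin N → ℂ, (starRingEnd ℂ) (dotc y z) = dotc z y := fun y z => by
        simp [dotc, mul_comm]
      rw [hconj, dotc_eq_sum_of_orthonormal hw, Fintype.sum_eq_add i j hij]
      · rw [hx, hx, hci, hcj, ← hconj (e i), ← hconj (e i), ← map_mul, ← map_mul, ← map_add, hαβ,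
          map_zero]
      · intro k hk
        rw [hx, hc k hk, map_zero, zero_mul]
    simpa using h
  have hpos : 0 < ∑ k, Complex.normSq (dotc (w k) x) := by
    rcases hne with h | h
    · refine Finset.sum_pos' (fun k _ => Complex.normSq_nonneg _) ⟨i, Finset.mem_univ i, ?_⟩
      rwa [hx, hci, Complex.normSq_pos]
    · refine Finset.sum_pos' (fun k _ => Complex.normSq_nonneg _) ⟨j, Finset.mem_univ j, ?_⟩
      rwa [hx, hcj, Complex.normSq_pos]
  refine le_of_mul_le_mul_right ?_ hpos
  calc d j * ∑ k, Complex.normSq (dotc (w k) x)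
      = ∑ k, d j * Complex.normSq (dotc (e k) x) := by
        rw [sum_normSq_dotc_eq he hw, Finset.mul_sum]
    _ ≤ ∑ k, d k * Complex.normSq (dotc (e k) x) := by
        refine Finset.sum_le_sum fun k _ => ?_
        by_cases hk : k = i
        · simp [hk, hex]
        · exact mul_le_mul_of_nonneg_right (hd k hk) (Complex.normSq_nonneg _)
    _ ≤ ∑ k, s k * Complex.normSq (dotc (w k) x) := by
        rw [sum_eigenvalues_Hmu hD he heig hw hweig]
        exact le_add_of_nonneg_right (mul_nonneg hμ (Complex.normSq_nonneg _))
    _ ≤ ∑ k, s j * Complex.normSq (dotc (w k) x) := by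
        refine Finset.sum_le_sum fun k _ => ?_
        by_cases hki : k = i
        · rw [hki]
          exact mul_le_mul_of_nonneg_right hs (Complex.normSq_nonneg _)
        by_cases hkj : k = j
        · rw [hkj]
        · simp [hx, hc k ⟨hki, hkj⟩]
    _ = s j * ∑ k, Complex.normSq (dotc (w k) x) := by rw [Finset.mul_sum]

end RankOne

theorem stmt12
    (N : ℕ) (hN : 2 ≤ N)
    (D : Matrix (Fin N) (Fin N) ℂ) (hD : D.IsHermitian)
    (d : Fin N → ℝ) (hd : StrictMono d)
    (e : Fin N → (Fin N → ℂ))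
    (he : ∀ k l, dotc (e k) (e l) = if k = l then 1 else 0)
    (heig : ∀ k, D.mulVec (e k) = (d k : ℂ) • e k)
    (s : ℝ → ℝ → Fin N → ℝ)
    (hsort : ∀ ε μ : ℝ, Monotone (s ε μ) ∧
      ∃ w : Fin N → (Fin N → ℂ),
        (∀ k l, dotc (w k) (w l) = if k = l then 1 else 0) ∧
        ∀ k, (Hmu D (edgeVec e (⟨0, by omega⟩ : Fin N) ε) μ).mulVec (w k)
          = ((s ε μ k : ℝ) : ℂ) • w k) :
    ∀ ε : ℝ, 0 < ε → ((N : ℝ) - 1) * ε ^ 2 < 1 / 2 →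
      ∀ μ : ℝ, 0 < μ →
        d ⟨1, by omega⟩ - s ε μ ⟨0, by omega⟩
            > ε ^ 2 * (d ⟨1, by omega⟩ - d ⟨0, by omega⟩) / 2 ∧
        d ⟨1, by omega⟩ ≤ s ε μ ⟨1, by omega⟩ ∧
        s ε μ ⟨1, by omega⟩ - s ε μ ⟨0, by omega⟩
            > ε ^ 2 * (d ⟨1, by omega⟩ - d ⟨0, by omega⟩) / 2 := by
  intro ε hε hsmall μ hμ
  obtain ⟨hmono, w, hw, hweig⟩ := hsort ε μ
  have hij : (⟨0, by omega⟩ : Fin N) ≠ ⟨1, by omega⟩ := by simp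
  have hgap : d ⟨0, by omega⟩ < d ⟨1, by omega⟩ := hd (by simp [Fin.lt_def])
  have hcoef : ∀ k, dotc (e k) (edgeVec e (⟨0, by omega⟩ : Fin N) ε) = _ :=
    dotc_linearCombination he _
  have hlow := lowest_eigenvalue_mul_le hD he heig hw hweig (m := ⟨0, by omega⟩)
    (fun k => hmono (by simp [Fin.le_def])) hij
    ((hcoef ⟨0, by omega⟩).trans (if_pos rfl)) ((hcoef ⟨1, by omega⟩).trans (if_neg hij.symm))
  have hsecond : d ⟨1, by omega⟩ ≤ s ε μ ⟨1, by omega⟩ := by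
    refine second_eigenvalue_le hD he heig hw hweig hμ.le hij (fun k hk => hd.monotone ?_)
      (hmono (by simp [Fin.le_def]))
    rw [Fin.le_def]
    exact Nat.one_le_iff_ne_zero.mpr fun h => hk (Fin.ext h)
  have hbound : d ⟨1, by omega⟩ - s ε μ ⟨0, by omega⟩ >
      ε ^ 2 * (d ⟨1, by omega⟩ - d ⟨0, by omega⟩) / 2 := by
    have hN' : (2 : ℝ) ≤ N := by exact_mod_cast hN
    have hε2 : ε ^ 2 < 1 / 2 := by nlinarith [sq_nonneg ε]
    have ha : 1 / 2 < 1 - ((N : ℝ) - 1) * ε ^ 2 := by linarith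
    have ha1 : 1 - ((N : ℝ) - 1) * ε ^ 2 ≤ 1 := by nlinarith [sq_nonneg ε]
    generalize 1 - ((N : ℝ) - 1) * ε ^ 2 = a at hlow ha ha1
    have hT : ε ^ 2 + a ^ 2 < 2 := by nlinarith
    have hT0 : 0 < ε ^ 2 + a ^ 2 := by positivity
    have hg : 0 < ε ^ 2 * (d ⟨1, by omega⟩ - d ⟨0, by omega⟩) :=
      mul_pos (by positivity) (sub_pos.mpr hgap)
    refine lt_of_mul_lt_mul_right ?_ hT0.le
    nlinarith
  exact ⟨hbound, hsecond, by linarith⟩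
end

section
/- Purity-based coherent information of the direct channel (Theorem on PI^d): let Ã, A, B be finite index types, let ã_i, ã_j be two orthonormal vectors in ℂ^Ã, let ψ, φ ∈ ℂ^{A×B} be unit vectors, let α, β ∈ ℂ, and set Ψ := α ã_i ⊗ ψ + β ã_j ⊗ φ ∈ ℂ^{Ã×A×B} with ρ := Ψ Ψ†. Let ρ_{ÃA} be the partial trace of ρ over B and ρ_A the partial trace of ρ over Ã and B. Then Tr(ρ_{ÃA}²) − Tr(ρ_A²) = 2 |α|² |β|² ( Tr[ Tr_B(ψ φ†) · Tr_B(φ ψ†) ] − Tr[ Tr_B(ψ ψ†) · Tr_B(φ φ†) ] ). -/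
open Matrix BigOperators

/-- Partial trace over the second tensor factor:
`(Tr_B M)_{a,a'} = Σ_b M_{(a,b),(a',b)}`. -/
noncomputable def ptraceSnd {A B : Type*} [Fintype B]
    (M : Matrix (A × B) (A × B) ℂ) : Matrix A A ℂ :=
  Matrix.of fun a a' => ∑ b, M (a, b) (a', b)

/-- Partial trace over the first tensor factor:
`(Tr_A M)_{b,b'} = Σ_a M_{(a,b),(a,b')}`. -/
noncomputable def ptraceFst {A B : Type*} [Fintype A]
    (M : Matrix (A × B) (A × B) ℂ) : Matrix B B ℂ :=
  Matrix.of fun b b' => ∑ a, M (a, b) (a, b')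

open scoped Kronecker

theorem dotc_eq_star_dotProduct {ι : Type*} [Fintype ι] (x y : ι → ℂ) :
    dotc x y = star x ⬝ᵥ y := rfl

theorem ptraceFst_add {A B : Type*} [Fintype A] (M N : Matrix (A × B) (A × B) ℂ) :
    ptraceFst (M + N) = ptraceFst M + ptraceFst N := by
  ext b b'
  simp [ptraceFst, Finset.sum_add_distrib]

theorem ptraceFst_smul {A B : Type*} [Fintype A] (c : ℂ) (M : Matrix (A × B) (A × B) ℂ) :
    ptraceFst (c • M) = c • ptraceFst M := by
  ext b b'
  simp [ptraceFst, Finset.mul_sum]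

theorem ptraceFst_kronecker {A B : Type*} [Fintype A] (M : Matrix A A ℂ) (N : Matrix B B ℂ) :
    ptraceFst (M ⊗ₖ N) = M.trace • N := by
  ext b b'
  simp [ptraceFst, Matrix.trace, Finset.sum_mul]

/-- The partial trace of the projector onto `α x ⊗ ψ + β y ⊗ φ`, in block form. -/
theorem ptraceSnd_superposition {C A B : Type*} [Fintype B] (x y : C → ℂ)
    (ψ φ : A × B → ℂ) (α β : ℂ) (Ψ : (C × A) × B → ℂ)
    (hΨ : ∀ p, Ψ p = α * x p.1.1 * ψ (p.1.2, p.2) + β * y p.1.1 * φ (p.1.2, p.2)) :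
    ptraceSnd (vecMulVec Ψ (star Ψ)) =
      (α * star α) • (vecMulVec x (star x) ⊗ₖ ptraceSnd (vecMulVec ψ (star ψ))) +
      (α * star β) • (vecMulVec x (star y) ⊗ₖ ptraceSnd (vecMulVec ψ (star φ))) +
      (β * star α) • (vecMulVec y (star x) ⊗ₖ ptraceSnd (vecMulVec φ (star ψ))) +
      (β * star β) • (vecMulVec y (star y) ⊗ₖ ptraceSnd (vecMulVec φ (star φ))) := by
  ext ⟨c, a⟩ ⟨c', a'⟩
  simp only [ptraceSnd, vecMulVec_apply, hΨ, of_apply, Matrix.add_apply, Matrix.smul_apply, kroneckerMap_apply,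
    Pi.star_apply, smul_eq_mul, Finset.mul_sum, ← Finset.sum_add_distrib, star_add, star_mul']
  exact Finset.sum_congr rfl fun b _ => by ring

theorem stmt14
    {At A B : Type*} [Fintype At] [Fintype A] [Fintype B]
    (ai aj : At → ℂ)
    (hii : dotc ai ai = 1) (hjj : dotc aj aj = 1) (hij : dotc ai aj = 0)
    (ψ φ : A × B → ℂ) (hψ : dotc ψ ψ = 1) (hφ : dotc φ φ = 1)
    (α β : ℂ) :
    let Ψ : (At × A) × B → ℂ :=
      fun x => α * ai x.1.1 * ψ (x.1.2, x.2) + β * aj x.1.1 * φ (x.1.2, x.2)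
    let ρ := Matrix.vecMulVec Ψ (star Ψ)
    let ρAA := ptraceSnd ρ
    let ρA := ptraceFst ρAA
    (ρAA * ρAA).trace - (ρA * ρA).trace =
      ((2 * Complex.normSq α * Complex.normSq β : ℝ) : ℂ) *
        ((ptraceSnd (Matrix.vecMulVec ψ (star φ)) *
            ptraceSnd (Matrix.vecMulVec φ (star ψ))).trace -
          (ptraceSnd (Matrix.vecMulVec ψ (star ψ)) *
            ptraceSnd (Matrix.vecMulVec φ (star φ))).trace) := by
  intro Ψ ρ ρAA ρA
  have hji : dotc aj ai = 0 := by
    rw [dotc_eq_star_dotProduct] at hij ⊢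
    rw [star_dotProduct, hij, star_zero]
  simp only [dotc_eq_star_dotProduct] at hii hjj hij hji
  have hAA : ρAA = _ := ptraceSnd_superposition ai aj ψ φ α β Ψ fun _ => rfl
  have hA : ρA = (α * star α) • ptraceSnd (vecMulVec ψ (star ψ)) +
      (β * star β) • ptraceSnd (vecMulVec φ (star φ)) := by
    simp only [ρA, hAA, ptraceFst_add, ptraceFst_smul, ptraceFst_kronecker, trace_vecMulVec,
      dotProduct_comm _ (star _), hii, hjj, hij, hji]
    simp
  have hnorm : ((2 * Complex.normSq α * Complex.normSq β : ℝ) : ℂ) =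
      2 * (α * star α) * (β * star β) := by
    simp [Complex.mul_conj]
  rw [hAA, hA, hnorm]
  simp only [add_mul, mul_add, Matrix.smul_mul, Matrix.mul_smul, ← mul_kronecker_mul, vecMulVec_mul_vecMulVec,
    hii, hjj, hij, hji, trace_add, trace_smul, trace_kronecker, trace_vecMulVec,
    dotProduct_comm _ (star _), smul_eq_mul, zero_smul, one_smul, vecMulVec_zero, trace_zero]
  rw [trace_mul_comm (ptraceSnd (vecMulVec φ (star ψ))) (ptraceSnd (vecMulVec ψ (star φ))),
    trace_mul_comm (ptraceSnd (vecMulVec φ (star φ))) (ptraceSnd (vecMulVec ψ (star ψ)))]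
  ring
end

section
/- Maximal entanglement transfer (Theorem 1, first part, in the edge-case limit): assume additionally d_{i1} < d_{j0}, and fix μ with d_{j0} − d_{i0} < μ < d_{j1} − d_{i0}. Then as ε → 0⁺ the purity of the reduced state on A converges to 1, Tr[ρ_A(ε, μ)²] → 1, while the purity of the reduced state on B converges to |α|⁴ + |β|⁴ < 1; i.e., in the edge-case limit system A ends up pure and unentangled and the initial Ã–A entanglement has been transferred to Ã–B. -/
open Matrix BigOperators

/-- The Kronecker sum `H_A ⊗ I + I ⊗ H_B`. -/
noncomputable def kronSum {n m : ℕ} (HA : Matrix (Fin n) (Fin n) ℂ)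
    (HB : Matrix (Fin m) (Fin m) ℂ) : Matrix (Fin n × Fin m) (Fin n × Fin m) ℂ :=
  Matrix.kroneckerMap (· * ·) HA (1 : Matrix (Fin m) (Fin m) ℂ) +
    Matrix.kroneckerMap (· * ·) (1 : Matrix (Fin n) (Fin n) ℂ) HB

/-- The edge-case vector on the product space: component `1 − (nm−1)ε²` along
`a i ⊗ b p₀` and `ε` along every other eigenvector `a k ⊗ b p` of `D`. -/
noncomputable def edgeVec2 {n m : ℕ} (a : Fin n → (Fin n → ℂ)) (b : Fin m → (Fin m → ℂ))
    (i : Fin n) (p₀ : Fin m) (ε : ℝ) : Fin n × Fin m → ℂ :=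
  fun q => ∑ k, ∑ p,
    (if k = i ∧ p = p₀ then (((1 : ℝ) - (((n * m : ℕ) : ℝ) - 1) * ε ^ 2 : ℝ) : ℂ)
      else (ε : ℂ)) * (a k q.1 * b p q.2)

/-- The product vector `x ⊗ y`. -/
def prodVec {A B : Type*} (x : A → ℂ) (y : B → ℂ) : A × B → ℂ := fun q => x q.1 * y q.2

theorem dotc_prodVec {A B : Type*} [Fintype A] [Fintype B] (x x' : A → ℂ) (y y' : B → ℂ) :
    dotc (prodVec x y) (prodVec x' y') = dotc x x' * dotc y y' := by
  simp only [dotc, prodVec, Fintype.sum_prod_type, Finset.sum_mul_sum, map_mul]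
  refine Finset.sum_congr rfl fun _ _ => Finset.sum_congr rfl fun _ _ => ?_
  ring

theorem dotc_smul_smul {ι : Type*} [Fintype ι] (c c' : ℂ) (x y : ι → ℂ) :
    dotc (c • x) (c' • y) = (starRingEnd ℂ) c * c' * dotc x y := by
  simp only [dotc, Finset.mul_sum, Pi.smul_apply, smul_eq_mul, map_mul]
  refine Finset.sum_congr rfl fun _ _ => ?_
  ring

theorem tendsto_dotc {X ι : Type*} [Fintype ι] {f : Filter X} {y z : X → ι → ℂ} {Y Z : ι → ℂ}
    (hy : Filter.Tendsto y f (nhds Y)) (hz : Filter.Tendsto z f (nhds Z)) :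
    Filter.Tendsto (fun x => dotc (y x) (z x)) f (nhds (dotc Y Z)) :=
  tendsto_finsetSum _ fun k _ => ((Complex.continuous_conj.tendsto _).comp
    (tendsto_pi_nhds.mp hy k)).mul (tendsto_pi_nhds.mp hz k)

theorem norm_apply_le_one_of_dotc_self {ι : Type*} [Fintype ι] {x : ι → ℂ}
    (h : dotc x x = 1) (k : ι) : ‖x k‖ ≤ 1 := by
  have h1 : ∑ k, ‖x k‖ ^ 2 = 1 := by
    have := congrArg Complex.re h
    simpa [dotc, ← Complex.normSq_eq_conj_mul_self, ← Complex.normSq_eq_norm_sq] using this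
  have h2 : ‖x k‖ ^ 2 ≤ 1 := h1 ▸
    Finset.single_le_sum (f := fun k => ‖x k‖ ^ 2) (fun _ _ => by positivity) (Finset.mem_univ k)
  exact (sq_le_one_iff₀ (norm_nonneg _)).mp h2

/-- A matrix with simple spectrum and orthonormal eigenbasis `e` has no normalized eigenvectors
other than multiples of the members of `e`. -/
theorem exists_eq_smul_of_mulVec_eq {Q : Type*} [Fintype Q] [DecidableEq Q]
    {M : Matrix Q Q ℂ} {e : Q → Q → ℂ} {l : Q → ℝ}
    (he : ∀ q r, dotc (e q) (e r) = if q = r then 1 else 0)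
    (hM : ∀ r, M.mulVec (e r) = (l r : ℂ) • e r) (hl : Function.Injective l)
    {U : Q → ℂ} {s : ℝ} (hU : M.mulVec U = (s : ℂ) • U) (hU1 : dotc U U = 1) :
    ∃ r, ∃ c : ℂ, s = l r ∧ U = c • e r := by
  set E : Matrix Q Q ℂ := Matrix.of fun q r => e r q with hE
  have hEE : Eᴴ * E = 1 := by
    ext q r
    simp only [Matrix.mul_apply, hE, Matrix.conjTranspose_apply, Matrix.of_apply,
      Matrix.one_apply, ← he q r]
    rfl
  have hEE' : E * Eᴴ = 1 := mul_eq_one_comm.mp hEE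
  set C := Eᴴ *ᵥ U with hC
  have hUC : U = E *ᵥ C := by rw [hC, Matrix.mulVec_mulVec, hEE', Matrix.one_mulVec]
  have hME : M * E = E * Matrix.diagonal fun r => (l r : ℂ) := by
    ext q r
    have := congrFun (hM r) q
    rw [Matrix.mul_diagonal, mul_comm]
    exact this
  have hCl : ∀ r, (l r : ℂ) * C r = s * C r := fun r => by
    have h1 : Eᴴ *ᵥ (M *ᵥ U) = (Matrix.diagonal fun r => (l r : ℂ)) *ᵥ C := by
      rw [hUC, Matrix.mulVec_mulVec, Matrix.mulVec_mulVec, mul_assoc, hME, ← mul_assoc, hEE,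
        one_mul]
    rw [hU, Matrix.mulVec_smul, ← hC] at h1
    have := congrFun h1 r
    rw [Matrix.mulVec_diagonal] at this
    simpa using this.symm
  have hC0 : C ≠ 0 := fun h0 => by
    rw [h0, Matrix.mulVec_zero] at hUC
    simp [hUC, dotc] at hU1
  obtain ⟨r, hr⟩ := Function.ne_iff.mp hC0
  have hsr : s = l r := by
    exact_mod_cast (mul_right_cancel₀ hr (hCl r)).symm
  refine ⟨r, C r, hsr, ?_⟩
  ext q
  rw [hUC, Matrix.mulVec, dotProduct, Finset.sum_eq_single r]
  · simp [hE, mul_comm]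
  · intro r' _ hne
    have : C r' = 0 := by
      by_contra h0
      have h2 : l r' = s := by exact_mod_cast mul_right_cancel₀ h0 (hCl r')
      exact hne (hl (h2.trans hsr))
    simp [this]
  · simp

/-- Along an ultrafilter, orthonormal eigenbases of a convergent family of matrices converge to an
orthonormal eigenbasis of the limit, and the eigenvalues converge accordingly. -/
theorem exists_limit_eigenbasis {X Q : Type*} [Fintype Q] [DecidableEq Q]
    (f : Ultrafilter X) {M : X → Matrix Q Q ℂ} {M₀ : Matrix Q Q ℂ}
    (hM : Filter.Tendsto M f (nhds M₀)) {s : X → Q → ℝ} {u : X → Q → Q → ℂ}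
    (horth : ∀ᶠ x in f, ∀ q q', dotc (u x q) (u x q') = if q = q' then 1 else 0)
    (heig : ∀ᶠ x in f, ∀ q, (M x).mulVec (u x q) = (s x q : ℂ) • u x q) :
    ∃ (U : Q → Q → ℂ) (S : Q → ℝ),
      Filter.Tendsto u f (nhds U) ∧ (∀ q, Filter.Tendsto (fun x => s x q) f (nhds (S q))) ∧
      (∀ q q', dotc (U q) (U q') = if q = q' then 1 else 0) ∧
      ∀ q, M₀.mulVec (U q) = (S q : ℂ) • U q := by
  have hball : ∀ᶠ x in f, u x ∈ Metric.closedBall (0 : Q → Q → ℂ) 1 := by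
    filter_upwards [horth] with x hx
    rw [mem_closedBall_zero_iff, pi_norm_le_iff_of_nonneg zero_le_one]
    intro q
    rw [pi_norm_le_iff_of_nonneg zero_le_one]
    exact norm_apply_le_one_of_dotc_self (by simpa using hx q q)
  obtain ⟨U, -, hU⟩ := (isCompact_closedBall (0 : Q → Q → ℂ) 1).ultrafilter_le_nhds (f.map u)
    (Filter.le_principal_iff.mpr hball)
  replace hU : Filter.Tendsto u f (nhds U) := hU
  have hUq : ∀ q, Filter.Tendsto (fun x => u x q) f (nhds (U q)) := tendsto_pi_nhds.mp hU
  have hMU : ∀ q, Filter.Tendsto (fun x => (M x).mulVec (u x q)) f (nhds (M₀.mulVec (U q))) :=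
    fun q => tendsto_pi_nhds.mpr fun k => tendsto_finsetSum _ fun k' _ =>
      (tendsto_pi_nhds.mp (tendsto_pi_nhds.mp hM k) k').mul (tendsto_pi_nhds.mp (hUq q) k')
  have hS : ∀ q, Filter.Tendsto (fun x => s x q) f
      (nhds (dotc (U q) (M₀.mulVec (U q))).re) := fun q => by
    refine ((Complex.continuous_re.tendsto _).comp (tendsto_dotc (hUq q) (hMU q))).congr' ?_
    filter_upwards [horth, heig] with x hx hx'
    have := dotc_smul_smul 1 (s x q : ℂ) (u x q) (u x q)
    rw [one_smul, hx q q] at this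
    rw [Function.comp_apply, hx' q, this]
    simp
  refine ⟨U, fun q => (dotc (U q) (M₀.mulVec (U q))).re, hU, hS, fun q q' => ?_, fun q => ?_⟩
  · refine tendsto_nhds_unique (tendsto_dotc (hUq q) (hUq q')) (tendsto_const_nhds.congr' ?_)
    filter_upwards [horth] with x hx using (hx q q').symm
  · refine tendsto_nhds_unique (hMU q)
      ((((Complex.continuous_ofReal.tendsto _).comp (hS q)).smul (hUq q)).congr' ?_)
    filter_upwards [heig] with x hx using (hx q).symm

/-- An injective self-map of a finite type that carries the order induced by `d` to the order
induced by `l` preserves ranks. -/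
theorem eq_of_card_lt_eq {Q : Type*} [Fintype Q] {d l : Q → ℝ}
    (hl : Function.Injective l) (hd : Function.Injective d) {σ : Q → Q}
    (hσ : Function.Injective σ) (hmono : ∀ q q', d q < d q' → l (σ q) ≤ l (σ q')) {x y : Q}
    (h : (Finset.univ.filter fun r => l r < l y).card =
      (Finset.univ.filter fun r => d r < d x).card) : σ x = y := by
  classical
  have hlt : ∀ q q', d q < d q' ↔ l (σ q) < l (σ q') := fun q q' => by
    constructor
    · intro hq
      exact (hmono q q' hq).lt_of_ne fun h' => hq.ne (congrArg d (hσ (hl h')))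
    · intro hq
      by_contra! h'
      rcases h'.lt_or_eq with h' | h'
      · exact (hmono _ _ h').not_gt hq
      · exact hq.ne (by rw [hd h'])
  have hcard : (Finset.univ.filter fun r => d r < d x).card =
      (Finset.univ.filter fun r => l r < l (σ x)).card := by
    rw [← Finset.card_image_of_injective _ hσ]
    congr 1
    ext r
    obtain ⟨q, rfl⟩ := Finite.surjective_of_injective hσ r
    simp [hσ.eq_iff, hlt]
  rw [hcard] at h
  have key : ∀ {z w : Q}, l z < l w → (Finset.univ.filter fun r => l r < l z).card <
      (Finset.univ.filter fun r => l r < l w).card := fun {z w} hzw => by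
    refine Finset.card_lt_card ((Finset.ssubset_iff_of_subset ?_).mpr
      ⟨z, by simpa using hzw, by simp⟩)
    intro r
    simpa using fun hr => hr.trans hzw
  rcases lt_trichotomy (l (σ x)) (l y) with h' | h' | h'
  · exact absurd h (key h').ne'
  · exact hl h'
  · exact absurd h (key h').ne

theorem ptraceSnd_vecMulVec_prodVec {A B : Type*} [Fintype B] (x : A → ℂ) (y : B → ℂ) :
    ptraceSnd (Matrix.vecMulVec (prodVec x y) (star (prodVec x y))) =
      dotc y y • Matrix.vecMulVec x (star x) := by
  ext k k'
  simp only [ptraceSnd, prodVec, dotc, Matrix.of_apply, Matrix.vecMulVec_apply, Pi.star_apply,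
    Matrix.smul_apply, smul_eq_mul, Finset.sum_mul, star_mul', starRingEnd_apply]
  refine Finset.sum_congr rfl fun _ _ => ?_
  ring

theorem ptraceFst_vecMulVec_prodVec {A B : Type*} [Fintype A] (x : A → ℂ) (y : B → ℂ) :
    ptraceFst (Matrix.vecMulVec (prodVec x y) (star (prodVec x y))) =
      dotc x x • Matrix.vecMulVec y (star y) := by
  ext k k'
  simp only [ptraceFst, prodVec, dotc, Matrix.of_apply, Matrix.vecMulVec_apply, Pi.star_apply,
    Matrix.smul_apply, smul_eq_mul, Finset.sum_mul, star_mul', starRingEnd_apply]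
  refine Finset.sum_congr rfl fun _ _ => ?_
  ring

theorem vecMulVec_smul_star {Q : Type*} {c : ℂ} (hc : (starRingEnd ℂ) c * c = 1) (x : Q → ℂ) :
    Matrix.vecMulVec (c • x) (star (c • x)) = Matrix.vecMulVec x (star x) := by
  ext k k'
  simp only [Matrix.vecMulVec_apply, Pi.star_apply, Pi.smul_apply, smul_eq_mul, star_mul']
  rw [starRingEnd_apply] at hc
  linear_combination (x k * star (x k')) * hc

theorem trace_vecMulVec_mul_vecMulVec {Q : Type*} [Fintype Q] (x y : Q → ℂ) :
    (Matrix.vecMulVec x (star x) * Matrix.vecMulVec y (star y)).trace = dotc x y * dotc y x := by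
  simp only [Matrix.trace, Matrix.diag_apply, Matrix.mul_apply, Matrix.vecMulVec_apply,
    Pi.star_apply, dotc, Finset.sum_mul_sum, starRingEnd_apply]
  rw [Finset.sum_comm]
  refine Finset.sum_congr rfl fun _ _ => Finset.sum_congr rfl fun _ _ => ?_
  ring

/-- Purity of a mixture of two pure states. -/
theorem trace_sq_mixture {Q : Type*} [Fintype Q] (s t : ℂ) (x y : Q → ℂ) :
    ((s • Matrix.vecMulVec x (star x) + t • Matrix.vecMulVec y (star y)) *
      (s • Matrix.vecMulVec x (star x) + t • Matrix.vecMulVec y (star y))).trace =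
      s ^ 2 * dotc x x ^ 2 + t ^ 2 * dotc y y ^ 2 + 2 * s * t * (dotc x y * dotc y x) := by
  simp only [add_mul, mul_add, Matrix.smul_mul, Matrix.mul_smul, Matrix.trace_add,
    Matrix.trace_smul, trace_vecMulVec_mul_vecMulVec, smul_eq_mul]
  ring

theorem edgeVec2_zero {n m : ℕ} (a : Fin n → (Fin n → ℂ)) (b : Fin m → (Fin m → ℂ))
    (i : Fin n) (p₀ : Fin m) : edgeVec2 a b i p₀ 0 = prodVec (a i) (b p₀) := by
  ext q
  simp only [edgeVec2, prodVec]
  rw [Finset.sum_eq_single i, Finset.sum_eq_single p₀]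
  · simp
  · intro p _ hp; simp [hp]
  · simp
  · intro k _ hk; simp [hk]
  · simp

theorem continuous_edgeVec2 {n m : ℕ} (a : Fin n → (Fin n → ℂ)) (b : Fin m → (Fin m → ℂ))
    (i : Fin n) (p₀ : Fin m) : Continuous (edgeVec2 a b i p₀) := by
  refine continuous_pi fun q => ?_
  unfold edgeVec2
  refine continuous_finsetSum _ fun k _ => continuous_finsetSum _ fun p _ => ?_
  split_ifs <;> fun_prop

theorem continuous_ptraceSnd {A B : Type*} [Fintype B] :
    Continuous (ptraceSnd : Matrix (A × B) (A × B) ℂ → Matrix A A ℂ) :=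
  continuous_matrix fun _ _ => continuous_finsetSum _ fun _ _ => continuous_id.matrix_elem _ _

theorem continuous_ptraceFst {A B : Type*} [Fintype A] :
    Continuous (ptraceFst : Matrix (A × B) (A × B) ℂ → Matrix B B ℂ) :=
  continuous_matrix fun _ _ => continuous_finsetSum _ fun _ _ => continuous_id.matrix_elem _ _

theorem stmt18
    (n m : ℕ) (hn : 2 ≤ n) (hm : 2 ≤ m)
    (HA : Matrix (Fin n) (Fin n) ℂ) (hHA : HA.IsHermitian)
    (HB : Matrix (Fin m) (Fin m) ℂ) (hHB : HB.IsHermitian)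
    (a : Fin n → (Fin n → ℂ)) (ha : ∀ k l, dotc (a k) (a l) = if k = l then 1 else 0)
    (b : Fin m → (Fin m → ℂ)) (hb : ∀ k l, dotc (b k) (b l) = if k = l then 1 else 0)
    (d : Fin n → Fin m → ℝ)
    (heig : ∀ k p, (kronSum HA HB).mulVec (fun q => a k q.1 * b p q.2) =
      (d k p : ℂ) • fun q => a k q.1 * b p q.2)
    (hdist : Function.Injective fun q : Fin n × Fin m => d q.1 q.2)
    (i j : Fin n) (hij : i < j)
    (p₀ p₁ : Fin m) (hp₀ : (p₀ : ℕ) = 0) (hp₁ : (p₁ : ℕ) = 1)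
    (hsucc_i : d i p₀ < d i p₁ ∧ ∀ k p, ¬(d i p₀ < d k p ∧ d k p < d i p₁))
    (hsucc_j : d j p₀ < d j p₁ ∧ ∀ k p, ¬(d j p₀ < d k p ∧ d k p < d j p₁))
    (hsep : d i p₁ < d j p₀)
    (α β : ℂ) (hnorm : Complex.normSq α + Complex.normSq β = 1) (hαβ : α * β ≠ 0)
    (μ : ℝ)
    (hμ₁ : d j p₀ - d i p₀ < μ) (hμ₂ : μ < d j p₁ - d i p₀)
    (sE : ℝ → (Fin n × Fin m) → ℝ)
    (u : ℝ → (Fin n × Fin m) → (Fin n × Fin m → ℂ))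
    (hu : ∀ ε : ℝ, 0 < ε → (((n * m : ℕ) : ℝ) - 1) * ε ^ 2 < 1 / 2 →
      (∀ q q', dotc (u ε q) (u ε q') = if q = q' then 1 else 0) ∧
      (∀ q, (kronSum HA HB + (μ : ℂ) •
          Matrix.vecMulVec (edgeVec2 a b i p₀ ε) (star (edgeVec2 a b i p₀ ε))).mulVec (u ε q)
        = ((sE ε q : ℝ) : ℂ) • u ε q) ∧
      (∀ q q' : Fin n × Fin m, d q.1 q.2 < d q'.1 q'.2 → sE ε q < sE ε q')) :
    let ρA : ℝ → Matrix (Fin n) (Fin n) ℂ := fun ε =>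
      ((Complex.normSq α : ℝ) : ℂ) •
        ptraceSnd (Matrix.vecMulVec (u ε (i, p₀)) (star (u ε (i, p₀)))) +
      ((Complex.normSq β : ℝ) : ℂ) •
        ptraceSnd (Matrix.vecMulVec (u ε (j, p₀)) (star (u ε (j, p₀))))
    let ρB : ℝ → Matrix (Fin m) (Fin m) ℂ := fun ε =>
      ((Complex.normSq α : ℝ) : ℂ) •
        ptraceFst (Matrix.vecMulVec (u ε (i, p₀)) (star (u ε (i, p₀)))) +
      ((Complex.normSq β : ℝ) : ℂ) •
        ptraceFst (Matrix.vecMulVec (u ε (j, p₀)) (star (u ε (j, p₀))))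
    Filter.Tendsto (fun ε : ℝ => (ρA ε * ρA ε).trace)
      (nhdsWithin 0 (Set.Ioi 0)) (nhds (1 : ℂ)) ∧
    Filter.Tendsto (fun ε : ℝ => (ρB ε * ρB ε).trace)
      (nhdsWithin 0 (Set.Ioi 0))
      (nhds ((Complex.normSq α ^ 2 + Complex.normSq β ^ 2 : ℝ) : ℂ)) ∧
    Complex.normSq α ^ 2 + Complex.normSq β ^ 2 < 1 := by
  intro ρA ρB
  have hp : p₁ ≠ p₀ := fun h => by simp [h, hp₀] at hp₁
  let e : Fin n × Fin m → Fin n × Fin m → ℂ := fun q => prodVec (a q.1) (b q.2)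
  have he : ∀ q r, dotc (e q) (e r) = if q = r then 1 else 0 := fun q r => by
    simp only [e, dotc_prodVec, ha, hb, Prod.ext_iff]
    split_ifs <;> simp_all
  let l : Fin n × Fin m → ℝ := fun q => if q = (i, p₀) then d i p₀ + μ else d q.1 q.2
  have hl₀ : l (i, p₀) = d i p₀ + μ := if_pos rfl
  have hl₁ : ∀ q, q ≠ (i, p₀) → l q = d q.1 q.2 := fun q hq => if_neg hq
  have hgap : ∀ q : Fin n × Fin m, d q.1 q.2 < d i p₀ + μ ↔ d q.1 q.2 ≤ d j p₀ := fun q => by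
    refine ⟨fun h => ?_, fun h => by linarith⟩
    by_contra! h'
    exact hsucc_j.2 q.1 q.2 ⟨h', by linarith⟩
  have hne : ∀ q : Fin n × Fin m, d q.1 q.2 ≠ d i p₀ + μ := fun q h =>
    hsucc_j.2 q.1 q.2 ⟨by linarith, by linarith⟩
  have hl : Function.Injective l := fun q r h => by
    by_cases hq : q = (i, p₀) <;> by_cases hr : r = (i, p₀)
    · rw [hq, hr]
    · rw [hq, hl₀, hl₁ r hr] at h
      exact absurd h.symm (hne r)
    · rw [hr, hl₀, hl₁ q hq] at h
      exact absurd h (hne q)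
    · rw [hl₁ q hq, hl₁ r hr] at h
      exact hdist h
  let M : ℝ → Matrix (Fin n × Fin m) (Fin n × Fin m) ℂ := fun ε => kronSum HA HB + (μ : ℂ) •
    Matrix.vecMulVec (edgeVec2 a b i p₀ ε) (star (edgeVec2 a b i p₀ ε))
  have hMc : Continuous M := by
    have hproj : Continuous fun ε => Matrix.vecMulVec (edgeVec2 a b i p₀ ε)
        (star (edgeVec2 a b i p₀ ε)) :=
      (continuous_edgeVec2 a b i p₀).matrix_vecMulVec (continuous_edgeVec2 a b i p₀).star
    exact continuous_const.add (hproj.fun_const_smul (μ : ℂ))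
  have hM₀ : ∀ r, (M 0).mulVec (e r) = (l r : ℂ) • e r := fun r => by
    have h1 : (kronSum HA HB).mulVec (e r) = (d r.1 r.2 : ℂ) • e r := heig r.1 r.2
    have h2 : Matrix.mulVec (Matrix.vecMulVec (e (i, p₀)) (star (e (i, p₀)))) (e r) =
        dotc (e (i, p₀)) (e r) • e (i, p₀) := by
      rw [Matrix.vecMulVec_mulVec, op_smul_eq_smul]
      rfl
    simp only [M, edgeVec2_zero]
    rw [Matrix.add_mulVec, Matrix.smul_mulVec, h1]
    erw [h2]
    rw [he]
    by_cases hr : r = (i, p₀)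
    · subst hr
      simp [hl₀, add_smul]
    · simp [hl₁ r hr, Ne.symm hr]
  have hrank_i : (Finset.univ.filter fun r => l r < l (i, p₁)).card =
      (Finset.univ.filter fun r : Fin n × Fin m => d r.1 r.2 < d i p₀).card := by
    congr 1
    ext r
    simp only [Finset.mem_filter, Finset.mem_univ, true_and]
    rw [hl₁ (i, p₁) (by simp [hp])]
    by_cases hr : r = (i, p₀)
    · subst hr
      rw [hl₀]
      simp only [lt_irrefl, iff_false]
      linarith
    · rw [hl₁ r hr]
      refine ⟨fun h => ?_, fun h => h.trans hsucc_i.1⟩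
      by_contra! h'
      rcases h'.lt_or_eq with h' | h'
      · exact hsucc_i.2 r.1 r.2 ⟨h', h⟩
      · exact hr (hdist h'.symm)
  have hrank_j : (Finset.univ.filter fun r => l r < l (i, p₀)).card =
      (Finset.univ.filter fun r : Fin n × Fin m => d r.1 r.2 < d j p₀).card := by
    have h1 : (Finset.univ.filter fun r => l r < l (i, p₀)) =
        (insert (j, p₀) (Finset.univ.filter fun r : Fin n × Fin m =>
          d r.1 r.2 < d j p₀)).erase (i, p₀) := by
      ext r
      simp only [Finset.mem_filter, Finset.mem_univ, true_and, Finset.mem_erase,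
        Finset.mem_insert]
      by_cases hr : r = (i, p₀)
      · simp [hr]
      · rw [hl₁ r hr, hl₀, hgap, le_iff_lt_or_eq, or_comm]
        have : d r.1 r.2 = d j p₀ ↔ r = (j, p₀) := hdist.eq_iff (a := r) (b := (j, p₀))
        simp [hr, this]
    rw [h1, Finset.card_erase_of_mem, Finset.card_insert_of_notMem]
    · simp
    · simp
    · simpa using Or.inr (hsucc_i.1.trans hsep)
  have hsmall : ∀ᶠ ε in nhdsWithin (0 : ℝ) (Set.Ioi 0),
      0 < ε ∧ (((n * m : ℕ) : ℝ) - 1) * ε ^ 2 < 1 / 2 := by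
    refine Filter.Eventually.and self_mem_nhdsWithin (Filter.Eventually.filter_mono
      nhdsWithin_le_nhds (ContinuousAt.eventually_lt (by fun_prop) (by fun_prop) (by norm_num)))
  have hlim : ∀ f : Ultrafilter ℝ, (f : Filter ℝ) ≤ nhdsWithin 0 (Set.Ioi 0) →
      ∃ c c' : ℂ, (starRingEnd ℂ) c * c = 1 ∧ (starRingEnd ℂ) c' * c' = 1 ∧
        Filter.Tendsto (fun ε => u ε (i, p₀)) f (nhds (c • e (i, p₁))) ∧
        Filter.Tendsto (fun ε => u ε (j, p₀)) f (nhds (c' • e (i, p₀))) := fun f hf => by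
    have hev := hsmall.filter_mono hf
    obtain ⟨U, S, hU, hS, horth, heigU⟩ := exists_limit_eigenbasis f
      ((hMc.tendsto 0).mono_left (hf.trans nhdsWithin_le_nhds))
      (hev.mono fun ε hε => (hu ε hε.1 hε.2).1) (hev.mono fun ε hε => (hu ε hε.1 hε.2).2.1)
    choose σ c hSσ hUσ using fun q => exists_eq_smul_of_mulVec_eq he hM₀ hl (heigU q)
      (by simpa using horth q q)
    have hc : ∀ q, (starRingEnd ℂ) (c q) * c q = 1 := fun q => by
      have := horth q q
      rw [hUσ q, dotc_smul_smul, he] at this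
      simpa using this
    have hσ : Function.Injective σ := fun q r h => by
      by_contra hqr
      have := horth q r
      rw [hUσ q, hUσ r, dotc_smul_smul, he, if_pos h, if_neg hqr, mul_one] at this
      rcases mul_eq_zero.mp this with h0 | h0
      · simpa [h0] using hc q
      · simpa [h0] using hc r
    have hmono : ∀ q q' : Fin n × Fin m, d q.1 q.2 < d q'.1 q'.2 → l (σ q) ≤ l (σ q') :=
      fun q q' hq => by
        rw [← hSσ, ← hSσ]
        exact le_of_tendsto_of_tendsto (hS q) (hS q')
          (hev.mono fun ε hε => ((hu ε hε.1 hε.2).2.2 q q' hq).le)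
    have hi : σ (i, p₀) = (i, p₁) := eq_of_card_lt_eq hl hdist hσ hmono hrank_i
    have hj : σ (j, p₀) = (i, p₀) := eq_of_card_lt_eq hl hdist hσ hmono hrank_j
    refine ⟨c (i, p₀), c (j, p₀), hc _, hc _, ?_, ?_⟩
    · rw [← hi, ← hUσ]
      exact tendsto_pi_nhds.mp hU _
    · rw [← hj, ← hUσ]
      exact tendsto_pi_nhds.mp hU _
  have hnormC : (Complex.normSq α : ℂ) + Complex.normSq β = 1 := by exact_mod_cast hnorm
  have hproj : Continuous fun x : Fin n × Fin m → ℂ => Matrix.vecMulVec x (star x) :=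
    continuous_id.matrix_vecMulVec continuous_id.star
  refine ⟨?_, ?_, ?_⟩
  · rw [Filter.tendsto_iff_ultrafilter]
    intro f hf
    obtain ⟨c, c', hc, hc', h1, h2⟩ := hlim f hf
    have hcont : Continuous fun x : Fin n × Fin m → ℂ =>
        ptraceSnd (Matrix.vecMulVec x (star x)) := continuous_ptraceSnd.comp hproj
    have hρ : Filter.Tendsto ρA f (nhds (((Complex.normSq α : ℝ) : ℂ) •
        Matrix.vecMulVec (a i) (star (a i)) + ((Complex.normSq β : ℝ) : ℂ) •
        Matrix.vecMulVec (a i) (star (a i)))) := by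
      have h3 := (hcont.tendsto _).comp h1
      have h4 := (hcont.tendsto _).comp h2
      rw [vecMulVec_smul_star hc, ptraceSnd_vecMulVec_prodVec, hb, if_pos rfl, one_smul] at h3
      rw [vecMulVec_smul_star hc', ptraceSnd_vecMulVec_prodVec, hb, if_pos rfl, one_smul] at h4
      exact (h3.const_smul _).add (h4.const_smul _)
    have htr : Continuous (Matrix.trace : Matrix (Fin n) (Fin n) ℂ → ℂ) :=
      continuous_id.matrix_trace
    have h5 := (htr.tendsto _).comp (hρ.mul hρ)
    rw [trace_sq_mixture] at h5
    simp only [ha, if_true] at h5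
    convert (show Filter.Tendsto (fun ε => (ρA ε * ρA ε).trace) f (nhds _) from h5) using 2
    linear_combination -(Complex.normSq α + Complex.normSq β + 1 : ℂ) * hnormC
  · rw [Filter.tendsto_iff_ultrafilter]
    intro f hf
    obtain ⟨c, c', hc, hc', h1, h2⟩ := hlim f hf
    have hcont : Continuous fun x : Fin n × Fin m → ℂ =>
        ptraceFst (Matrix.vecMulVec x (star x)) := continuous_ptraceFst.comp hproj
    have hρ : Filter.Tendsto ρB f (nhds (((Complex.normSq α : ℝ) : ℂ) •
        Matrix.vecMulVec (b p₁) (star (b p₁)) + ((Complex.normSq β : ℝ) : ℂ) •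
        Matrix.vecMulVec (b p₀) (star (b p₀)))) := by
      have h3 := (hcont.tendsto _).comp h1
      have h4 := (hcont.tendsto _).comp h2
      rw [vecMulVec_smul_star hc, ptraceFst_vecMulVec_prodVec, ha, if_pos rfl, one_smul] at h3
      rw [vecMulVec_smul_star hc', ptraceFst_vecMulVec_prodVec, ha, if_pos rfl, one_smul] at h4
      exact (h3.const_smul _).add (h4.const_smul _)
    have htr : Continuous (Matrix.trace : Matrix (Fin m) (Fin m) ℂ → ℂ) :=
      continuous_id.matrix_trace
    have h5 := (htr.tendsto _).comp (hρ.mul hρ)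
    rw [trace_sq_mixture] at h5
    simp only [hb, if_true, if_neg hp] at h5
    convert (show Filter.Tendsto (fun ε => (ρB ε * ρB ε).trace) f (nhds _) from h5) using 2
    push_cast
    ring
  · have hα := Complex.normSq_pos.mpr (left_ne_zero_of_mul hαβ)
    have hβ := Complex.normSq_pos.mpr (right_ne_zero_of_mul hαβ)
    nlinarith [mul_pos hα hβ]
end
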